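/- arXiv:2203.16619 — 8 statements merged into one kernel-verified Lean document; each statement's English description precedes it below -/
import Mathlib

section
/- Let 2 ≤ n ≤ m. The gonality of the two-dimensional rook graph K_n □ K_m (the Cartesian/box product of the complete graphs on n and m vertices) equals (n-1)·m. -/
/-- Decidability of adjacency in a box product of simple graphs. -/
instance {α β : Type*} (G : SimpleGraph α) (H : SimpleGraph β) [DecidableEq α] [DecidableEq β]
    [DecidableRel G.Adj] [DecidableRel H.Adj] : DecidableRel (G □ H).Adj := fun _ _ =>
  decidable_of_iff _ SimpleGraph.boxProd_adj.symm

/-- The degree of a divisor: the sum of its values. -/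
def degD {V : Type*} [Fintype V] (D : V → ℤ) : ℤ := ∑ v, D v

/-- A divisor is effective if all its values are nonnegative. -/
def Effective {V : Type*} (D : V → ℤ) : Prop := ∀ v, 0 ≤ D v

/-- The number of edges from the vertex `v` to the vertex set `A`. -/
def edgesTo {V : Type*} [DecidableEq V] (G : SimpleGraph V) [DecidableRel G.Adj]
    (v : V) (A : Finset V) : ℕ := (A.filter (fun u => G.Adj v u)).card

/-- The divisor obtained from `D` by firing the vertex subset `A`: every vertex of `A`
sends one chip along each edge leaving `A`. -/
def fire {V : Type*} [Fintype V] [DecidableEq V] (G : SimpleGraph V) [DecidableRel G.Adj]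
    (D : V → ℤ) (A : Finset V) : V → ℤ :=
  fun v => if v ∈ A then D v - edgesTo G v Aᶜ else D v + edgesTo G v A

/-- Two divisors are equivalent if one is obtained from the other by a finite
sequence of subset firings. -/
def LinEquiv {V : Type*} [Fintype V] [DecidableEq V] (G : SimpleGraph V) [DecidableRel G.Adj]
    (D D' : V → ℤ) : Prop :=
  Relation.ReflTransGen (fun D₁ D₂ => ∃ A : Finset V, D₂ = fire G D₁ A) D D'

/-- A divisor `D` has rank at least `r` if for every effective divisor `E` of degree `r`,
`D - E` is equivalent to an effective divisor. -/
def RankGE {V : Type*} [Fintype V] [DecidableEq V] (G : SimpleGraph V) [DecidableRel G.Adj]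
    (D : V → ℤ) (r : ℕ) : Prop :=
  ∀ E : V → ℤ, Effective E → degD E = (r : ℤ) →
    ∃ D', LinEquiv G (D - E) D' ∧ Effective D'

/-- The `k`-gonality of a graph: the minimal degree of a divisor of rank at least `k`. -/
noncomputable def kGonality {V : Type*} [Fintype V] [DecidableEq V] (G : SimpleGraph V)
    [DecidableRel G.Adj] (k : ℕ) : ℕ :=
  sInf {d : ℕ | ∃ D : V → ℤ, RankGE G D k ∧ degD D = (d : ℤ)}

/-- The gonality of a graph: the minimal degree of a divisor of rank at least `1`. -/
noncomputable def gonality {V : Type*} [Fintype V] [DecidableEq V] (G : SimpleGraph V)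
    [DecidableRel G.Adj] : ℕ := kGonality G 1

/-- The two-dimensional rook graph `K_n □ K_m`: the box product of the complete graphs
on `n` and `m` vertices. -/
def rook (n m : ℕ) : SimpleGraph (Fin n × Fin m) :=
  (⊤ : SimpleGraph (Fin n)) □ (⊤ : SimpleGraph (Fin m))

instance (n m : ℕ) : DecidableRel (rook n m).Adj := by unfold rook; infer_instance

open Finset

/-- The graph Laplacian of the rook graph. -/
def rookLap {n m : ℕ} (f : Fin n × Fin m → ℤ) (v : Fin n × Fin m) : ℤ :=
  (n * f v - ∑ i, f (i, v.2)) + (m * f v - ∑ j, f (v.1, j))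

/-- The indicator function of a finset, with integer values. -/
def ind {V : Type*} [DecidableEq V] (A : Finset V) (v : V) : ℤ := if v ∈ A then 1 else 0

theorem ind_nonneg {V : Type*} [DecidableEq V] (A : Finset V) (v : V) : 0 ≤ ind A v := by
  unfold ind; split_ifs <;> simp

theorem ind_le_one {V : Type*} [DecidableEq V] (A : Finset V) (v : V) : ind A v ≤ 1 := by
  unfold ind; split_ifs <;> simp

theorem rookLap_add {n m : ℕ} (f g : Fin n × Fin m → ℤ) (v : Fin n × Fin m) :
    rookLap (fun u => f u + g u) v = rookLap f v + rookLap g v := by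
  simp only [rookLap, sum_add_distrib]; ring

theorem rookLap_sub {n m : ℕ} (f g : Fin n × Fin m → ℤ) (v : Fin n × Fin m) :
    rookLap (fun u => f u - g u) v = rookLap f v - rookLap g v := by
  simp only [rookLap, sum_sub_distrib]; ring

theorem sum_col_rookLap {n m : ℕ} (f : Fin n × Fin m → ℤ) (j : Fin m) :
    ∑ i, rookLap f (i, j) = m * ∑ i, f (i, j) - ∑ i, ∑ j, f (i, j) := by
  simp only [rookLap, sum_add_distrib, sum_sub_distrib, ← mul_sum]
  simp

theorem degD_eq_sum_col {n m : ℕ} (D : Fin n × Fin m → ℤ) : degD D = ∑ j, ∑ i, D (i, j) := by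
  rw [degD, Fintype.sum_prod_type, sum_comm]

theorem degD_eq_sum_row {n m : ℕ} (D : Fin n × Fin m → ℤ) : degD D = ∑ i, ∑ j, D (i, j) := by
  rw [degD, Fintype.sum_prod_type]

theorem degD_rookLap {n m : ℕ} (f : Fin n × Fin m → ℤ) : degD (rookLap f) = 0 := by
  rw [degD_eq_sum_col]
  simp only [sum_col_rookLap, sum_sub_distrib, ← mul_sum]
  rw [sum_comm]
  simp

theorem edgesTo_rook {n m : ℕ} (v : Fin n × Fin m) (A : Finset (Fin n × Fin m)) :
    (edgesTo (rook n m) v A : ℤ) =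
      ∑ i, ind A (i, v.2) + ∑ j, ind A (v.1, j) - 2 * ind A v := by
  obtain ⟨a, b⟩ := v
  have split_adj : ∀ u : Fin n × Fin m,
      (if u ∈ A ∧ (rook n m).Adj (a, b) u then (1 : ℤ) else 0) =
        (if b = u.2 then ind A u else 0) + (if a = u.1 then ind A u else 0)
          - 2 * (if a = u.1 then if b = u.2 then ind A u else 0 else 0) := by
    rintro ⟨i, j⟩
    simp only [rook, SimpleGraph.boxProd_adj, SimpleGraph.top_adj, ind]
    split_ifs <;> simp_all
  have card_eq : (edgesTo (rook n m) (a, b) A : ℤ) =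
      ∑ u, if u ∈ A ∧ (rook n m).Adj (a, b) u then (1 : ℤ) else 0 := by
    rw [edgesTo, sum_boole, ← filter_filter, filter_mem_eq_inter, univ_inter]
  rw [card_eq, sum_congr rfl fun u _ => split_adj u]
  simp only [sum_sub_distrib, sum_add_distrib, ← mul_sum, Fintype.sum_prod_type]
  simp only [sum_ite_eq, mem_univ, if_true]
  congr 2 <;> rw [sum_comm] <;> simp

theorem fire_rook {n m : ℕ} (D : Fin n × Fin m → ℤ) (A : Finset (Fin n × Fin m))
    (v : Fin n × Fin m) : fire (rook n m) D A v = D v - rookLap (ind A) v := by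
  have ind_compl : ∀ u, ind Aᶜ u = 1 - ind A u := fun u => by
    unfold ind; by_cases hu : u ∈ A <;> simp [hu]
  by_cases hv : v ∈ A
  · have hv1 : ind A v = 1 := by simp [ind, hv]
    simp only [fire, hv, if_true, edgesTo_rook, ind_compl, sum_sub_distrib, rookLap, hv1]
    simp
  · have hv0 : ind A v = 0 := by simp [ind, hv]
    simp only [fire, hv, if_false, edgesTo_rook, rookLap, hv0]
    ring

theorem LinEquiv.exists_rookLap {n m : ℕ} {D D' : Fin n × Fin m → ℤ}
    (h : LinEquiv (rook n m) D D') : ∃ f, ∀ v, D' v = D v - rookLap f v := by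
  induction h with
  | refl => exact ⟨fun _ => 0, fun v => by simp [rookLap]⟩
  | tail _ hstep ih =>
    obtain ⟨f, hf⟩ := ih
    obtain ⟨A, rfl⟩ := hstep
    refine ⟨fun u => f u + ind A u, fun v => ?_⟩
    rw [fire_rook, hf, rookLap_add]
    ring

/-- If a firing script keeps an effective divisor effective and brings chips to `q`, then some nonempty set avoiding `q` can be fired keeping the divisor effective. -/
theorem exists_legal_firing {n m : ℕ} {D f : Fin n × Fin m → ℤ} {q : Fin n × Fin m}
    (hD : Effective D) (hf : ∀ v, rookLap f v ≤ D v) (hfq : rookLap f q < 0) :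
    ∃ A : Finset (Fin n × Fin m), A.Nonempty ∧ q ∉ A ∧ ∀ v, rookLap (ind A) v ≤ D v := by
  obtain ⟨w, -, hw⟩ := exists_max_image univ f ⟨q, mem_univ q⟩
  have hw' : ∀ v, f v ≤ f w := fun v => hw v (mem_univ v)
  let A : Finset (Fin n × Fin m) := univ.filter fun v => f v = f w
  have mem_A : ∀ v, v ∈ A ↔ f v = f w := fun v => by simp [A]
  have lap_le : ∀ v ∈ A, rookLap (ind A) v ≤ rookLap f v := by
    intro v hv
    have key : ∀ u, f u - ind A u ≤ f w - 1 := by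
      intro u
      have := hw' u
      unfold ind
      split_ifs with hu
      · rw [mem_A] at hu; omega
      · rw [mem_A] at hu; omega
    have h1 := sum_le_sum fun i (_ : i ∈ univ) => key (i, v.2)
    have h2 := sum_le_sum fun j (_ : j ∈ univ) => key (v.1, j)
    have hv1 : ind A v = 1 := by simp [ind, hv]
    have hvw := (mem_A v).1 hv
    simp only [sum_sub_distrib, sum_const, card_univ, Fintype.card_fin, nsmul_eq_mul] at h1 h2
    simp only [rookLap, hv1, hvw]
    linarith
  have lap_nonneg : ∀ v ∈ A, 0 ≤ rookLap (ind A) v := by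
    intro v hv
    have hv1 : ind A v = 1 := by simp [ind, hv]
    have h1 := sum_le_sum fun i (_ : i ∈ univ) => ind_le_one A ((i, v.2) : Fin n × Fin m)
    have h2 := sum_le_sum fun j (_ : j ∈ univ) => ind_le_one A ((v.1, j) : Fin n × Fin m)
    simp only [sum_const, card_univ, Fintype.card_fin, nsmul_eq_mul] at h1 h2
    simp only [rookLap, hv1]
    linarith
  refine ⟨A, ⟨w, by simp [A]⟩, fun hqA => ?_, fun v => ?_⟩
  · linarith [lap_le q hqA, lap_nonneg q hqA]
  · by_cases hv : v ∈ A
    · exact (lap_le v hv).trans (hf v)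
    · have hv0 : ind A v = 0 := by simp [ind, hv]
      have h1 := sum_nonneg fun i (_ : i ∈ univ) => ind_nonneg A ((i, v.2) : Fin n × Fin m)
      have h2 := sum_nonneg fun j (_ : j ∈ univ) => ind_nonneg A ((v.1, j) : Fin n × Fin m)
      have := hD v
      simp only [rookLap, hv0]
      linarith

/-- If each of `k` values, of which some but not all are `0` and the others `1`, sends one chip
to each value of the other kind, at least `k - 1` chips are sent. -/
theorem sub_one_le_sum_mul {k : ℕ} {g x : Fin k → ℤ} {c : ℤ} (hc : c = ∑ i, g i)
    (h1 : 1 ≤ c) (h2 : c ≤ k - 1) (hx : ∀ i, g i * (k - c) ≤ x i) : (k : ℤ) - 1 ≤ ∑ i, x i := by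
  have h := sum_le_sum fun i (_ : i ∈ univ) => hx i
  rw [← sum_mul, ← hc] at h
  nlinarith

/-- The sum of the column sums of a divisor, truncated at `n - 1`. -/
def colPotential {n m : ℕ} (D : Fin n × Fin m → ℤ) : ℤ := ∑ j, min (∑ i, D (i, j)) (n - 1 : ℤ)

theorem colPotential_le {n m : ℕ} (D : Fin n × Fin m → ℤ) : colPotential D ≤ m * (n - 1 : ℤ) := by
  exact (sum_le_sum fun j _ => min_le_right _ _).trans (by simp [mul_sub])

/-- Firing a nonempty set that avoids a chipless vertex of a column with at most `n - 2` chips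
increases the column potential. -/
theorem colPotential_lt {n m : ℕ} (hnm : n ≤ m) {D : Fin n × Fin m → ℤ} (hD : Effective D)
    (hdeg : degD D < m * (n - 1 : ℤ)) {A : Finset (Fin n × Fin m)} (hA : A.Nonempty)
    (hlegal : ∀ v, rookLap (ind A) v ≤ D v) {a : Fin n} {b : Fin m} (hab : (a, b) ∉ A)
    (hb : ∑ i, D (i, b) < n - 1) :
    colPotential D < colPotential fun v => D v - rookLap (ind A) v := by
  have hg0 := ind_nonneg A
  have hg1 := ind_le_one A
  have hg : ∀ v, ind A v = 0 ∨ ind A v = 1 := fun v => by unfold ind; split_ifs <;> simp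
  set c : Fin m → ℤ := fun j => ∑ i, ind A (i, j) with hc
  set r : Fin n → ℤ := fun i => ∑ j, ind A (i, j) with hr
  have lap_eq : ∀ i j, rookLap (ind A) (i, j) =
      (n * ind A (i, j) - c j) + (m * ind A (i, j) - r i) := fun i j => rfl
  have c_nonneg : ∀ j, 0 ≤ c j := fun j => sum_nonneg fun i _ => hg0 _
  have r_nonneg : ∀ i, 0 ≤ r i := fun i => sum_nonneg fun j _ => hg0 _
  have c_le : ∀ j, c j ≤ n := fun j =>
    (sum_le_sum fun i _ => hg1 (i, j)).trans (by simp)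
  have r_le : ∀ i, r i ≤ m := fun i =>
    (sum_le_sum fun j _ => hg1 (i, j)).trans (by simp)
  have col_le : ∀ i j, ind A (i, j) * (n - c j) ≤ D (i, j) := fun i j => by
    have h1 := hlegal (i, j)
    have h2 := hD (i, j)
    have h3 := r_le i
    rw [lap_eq] at h1
    rcases hg (i, j) with h | h <;> rw [h] at h1 ⊢ <;> linarith
  have row_le : ∀ i j, ind A (i, j) * (m - r i) ≤ D (i, j) := fun i j => by
    have h1 := hlegal (i, j)
    have h2 := hD (i, j)
    have h3 := c_le j
    rw [lap_eq] at h1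
    rcases hg (i, j) with h | h <;> rw [h] at h1 ⊢ <;> linarith
  have col_le' : ∀ i j, (1 - ind A (i, j)) * c j ≤ D (i, j) - rookLap (ind A) (i, j) :=
    fun i j => by
      have h1 := hlegal (i, j)
      have h2 := hD (i, j)
      have h3 := r_nonneg i
      rw [lap_eq] at h1 ⊢
      rcases hg (i, j) with h | h <;> rw [h] at h1 ⊢ <;> linarith
  have total_pos : 0 < ∑ i, ∑ j, ind A (i, j) := by
    obtain ⟨w, hw⟩ := hA
    rw [← Fintype.sum_prod_type]
    refine sum_pos' (fun v _ => hg0 v) ⟨w, mem_univ w, by simp [ind, hw]⟩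
  have cb_lt : c b < n := by
    have : ∑ i, ind A (i, b) < ∑ _i : Fin n, (1 : ℤ) :=
      sum_lt_sum (fun i _ => hg1 _) ⟨a, mem_univ a, by simp [ind, hab]⟩
    simpa [hc] using this
  have cb_zero : c b = 0 := by
    by_contra hne
    have := c_nonneg b
    have := sub_one_le_sum_mul (c := c b) rfl (by omega) (by omega) fun i => col_le i b
    omega
  have ind_b : ∀ i, ind A (i, b) = 0 := fun i =>
    (sum_eq_zero_iff_of_nonneg fun i _ => hg0 (i, b)).1 cb_zero i (mem_univ i)
  have c_lt : ∀ j, c j < n := by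
    intro j
    by_contra hj
    have hcj : c j = n := le_antisymm (c_le j) (not_lt.1 hj)
    have ind_j : ∀ i, ind A (i, j) = 1 := by
      intro i
      by_contra hne
      have : ∑ i, ind A (i, j) < ∑ _i : Fin n, (1 : ℤ) :=
        sum_lt_sum (fun i _ => hg1 _) ⟨i, mem_univ i, lt_of_le_of_ne (hg1 _) hne⟩
      simp only [sum_const, card_univ, Fintype.card_fin, nsmul_eq_mul, mul_one] at this
      exact this.ne hcj
    have row_ge : ∀ i, (m : ℤ) - 1 ≤ ∑ j, D (i, j) := by
      intro i
      have r_pos : 0 < r i := sum_pos' (fun j _ => hg0 _) ⟨j, mem_univ j, by simp [ind_j]⟩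
      have r_lt : r i < m := by
        have : ∑ j, ind A (i, j) < ∑ _j : Fin m, (1 : ℤ) :=
          sum_lt_sum (fun j _ => hg1 _) ⟨b, mem_univ b, by simp [ind_b]⟩
        simpa [hr] using this
      exact sub_one_le_sum_mul (c := r i) rfl (by omega) (by omega) fun j => row_le i j
    have h := sum_le_sum fun i (_ : i ∈ univ) => row_ge i
    rw [← degD_eq_sum_row] at h
    simp only [sum_const, card_univ, Fintype.card_fin, nsmul_eq_mul] at h
    have : (n : ℤ) ≤ m := by exact_mod_cast hnm
    nlinarith
  have col_gain : ∀ j, c j = 0 → ∑ i, D (i, j) < ∑ i, (D (i, j) - rookLap (ind A) (i, j)) := by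
    intro j hj
    have h := sum_col_rookLap (ind A) j
    rw [show ∑ i, ind A (i, j) = 0 from hj] at h
    rw [sum_sub_distrib, h]
    linarith
  refine sum_lt_sum (fun j _ => ?_) ⟨b, mem_univ b, ?_⟩
  · rcases (c_nonneg j).eq_or_lt with hj | hj
    · exact min_le_min_right _ (col_gain j hj.symm).le
    · have h := sum_le_sum fun i (_ : i ∈ univ) => col_le' i j
      rw [← sum_mul, sum_sub_distrib, show ∑ i, ind A (i, j) = c j from rfl] at h
      simp only [sum_const, card_univ, Fintype.card_fin, nsmul_eq_mul, mul_one] at h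
      have := c_lt j
      exact (min_le_right _ _).trans (le_min (by nlinarith) le_rfl)
  · have := col_gain b cb_zero
    exact lt_min ((min_le_left _ _).trans_lt this) ((min_le_left _ _).trans_lt hb)

theorem le_degD_of_rankGE_one {n m : ℕ} (hn : 2 ≤ n) (hnm : n ≤ m) {D : Fin n × Fin m → ℤ}
    (hD : RankGE (rook n m) D 1) : m * (n - 1 : ℤ) ≤ degD D := by
  by_contra! hdeg
  have reach : ∀ q, ∃ g, ∀ v, ind {q} v ≤ D v - rookLap g v := by
    intro q
    obtain ⟨D', hlin, heff⟩ := hD (ind {q}) (ind_nonneg _) (by simp [degD, ind])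
    obtain ⟨g, hg⟩ := hlin.exists_rookLap
    refine ⟨g, fun v => ?_⟩
    have h1 := heff v
    rw [hg, Pi.sub_apply] at h1
    linarith
  obtain ⟨p, ⟨f, hf, rfl⟩, hmax⟩ := Int.exists_greatest_of_bdd
    (P := fun p => ∃ f, Effective (fun v => D v - rookLap f v) ∧
      colPotential (fun v => D v - rookLap f v) = p)
    ⟨m * (n - 1 : ℤ), by rintro _ ⟨f, -, rfl⟩; exact colPotential_le _⟩
    (by
      obtain ⟨g, hg⟩ := reach (⟨0, by omega⟩, ⟨0, by omega⟩)
      exact ⟨_, g, fun v => (ind_nonneg _ v).trans (hg v), rfl⟩)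
  have hdeg' : degD (fun v => D v - rookLap f v) < m * (n - 1 : ℤ) := by
    have : degD (fun v => D v - rookLap f v) = degD D - degD (rookLap f) := by simp [degD]
    rw [this, degD_rookLap]
    linarith
  obtain ⟨b, hb⟩ : ∃ b, ∑ i, (D (i, b) - rookLap f (i, b)) < n - 1 := by
    by_contra! h
    have h := sum_le_sum fun j (_ : j ∈ univ) => h j
    rw [← degD_eq_sum_col fun v => D v - rookLap f v] at h
    simp only [sum_const, card_univ, Fintype.card_fin, nsmul_eq_mul] at h
    linarith
  obtain ⟨a, ha⟩ : ∃ a, D (a, b) - rookLap f (a, b) = 0 := by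
    by_contra! h
    have h : ∀ i, 1 ≤ D (i, b) - rookLap f (i, b) := fun i => by
      have h1 : 0 ≤ D (i, b) - rookLap f (i, b) := hf (i, b)
      have h2 := h i
      omega
    have h := sum_le_sum fun i (_ : i ∈ univ) => h i
    simp only [sum_const, card_univ, Fintype.card_fin, nsmul_eq_mul] at h
    linarith
  obtain ⟨g, hg⟩ := reach (a, b)
  obtain ⟨A, hA, hqA, hlegal⟩ := exists_legal_firing (f := fun v => g v - f v) hf
    (fun v => by
      rw [rookLap_sub]
      linarith [hg v, ind_nonneg {(a, b)} v])
    (by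
      have h1 := hg (a, b)
      have h2 : ind {(a, b)} (a, b) = 1 := by simp [ind]
      rw [rookLap_sub]
      linarith)
  have hlt := colPotential_lt hnm hf hdeg' hA hlegal hqA hb
  have hcomp : (fun v => D v - rookLap f v - rookLap (ind A) v) =
      fun v => D v - rookLap (fun u => f u + ind A u) v := by
    funext v
    rw [rookLap_add]
    ring
  rw [hcomp] at hlt
  refine absurd (hmax _ ⟨_, fun v => ?_, rfl⟩) (not_le.2 hlt)
  have := hlegal v
  beta_reduce
  rw [rookLap_add]
  linarith

/-- The divisor with `n - 1` chips on each vertex of one copy of `K_m` has rank at least `1`. -/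
theorem rankGE_one_row {n m : ℕ} (hn : 2 ≤ n) (o : Fin n) :
    RankGE (rook n m) (fun v => if v.1 = o then (n - 1 : ℤ) else 0) 1 := by
  intro E hE hdeg
  have hn' : (2 : ℤ) ≤ n := by exact_mod_cast hn
  rw [degD, Nat.cast_one] at hdeg
  have E_le : ∀ v, E v ≤ 1 := fun v =>
    (single_le_sum (fun u _ => hE u) (mem_univ v)).trans hdeg.le
  by_cases h : ∃ w, w.1 ≠ o ∧ 1 ≤ E w
  · obtain ⟨w, hwo, hw⟩ := h
    have E_row : ∀ v : Fin n × Fin m, v.1 = o → E v ≤ 0 := by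
      intro v hv
      have hvw : v ≠ w := by rintro rfl; exact hwo hv
      have h1 := sum_le_sum_of_subset_of_nonneg (subset_univ {v, w}) fun u _ _ => hE u
      rw [sum_pair hvw] at h1
      linarith
    refine ⟨_, .single ⟨univ.filter fun v => v.1 = o, rfl⟩, fun v => ?_⟩
    have h1 := E_le v
    rw [fire_rook]
    by_cases hv : v.1 = o
    · have := E_row v hv
      simp [rookLap, ind, hv]
      linarith
    · simp [rookLap, ind, hv]
      linarith
  · push Not at h
    refine ⟨_, .refl, fun v => ?_⟩
    have h1 := E_le v
    by_cases hv : v.1 = o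
    · simp only [Pi.sub_apply, hv, if_true]
      linarith
    · have := h v hv
      simp only [Pi.sub_apply, hv, if_false]
      linarith

/-- The gonality of the rook graph `K_n □ K_m` for `2 ≤ n ≤ m` is `(n - 1) * m`. -/
theorem gonality_rook (n m : ℕ) (hn : 2 ≤ n) (hnm : n ≤ m) :
    gonality (rook n m) = (n - 1) * m := by
  have cast_eq : (((n - 1) * m : ℕ) : ℤ) = m * (n - 1 : ℤ) := by
    push_cast [show 1 ≤ n by omega]
    ring
  have mem : (n - 1) * m ∈
      {d : ℕ | ∃ D : Fin n × Fin m → ℤ, RankGE (rook n m) D 1 ∧ degD D = (d : ℤ)} := by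
    refine ⟨_, rankGE_one_row hn ⟨0, by omega⟩, ?_⟩
    rw [cast_eq, degD_eq_sum_col]
    simp [mul_sub]
  refine le_antisymm (Nat.sInf_le mem) (le_csInf ⟨_, mem⟩ ?_)
  rintro d ⟨D, hD, hd⟩
  have h := le_degD_of_rankGE_one hn hnm hD
  rw [hd, ← cast_eq] at h
  exact_mod_cast h
end

section
/- Let 2 ≤ n ≤ m. On the rook graph K_n □ K_m there exists a divisor of degree (n-1)·m having rank at least 1; namely, the divisor that places one chip on every vertex except on the vertices of one fixed row (one copy of K_m), which receive zero chips, has positive rank. Hence gon(K_n □ K_m) ≤ (n-1)·m. -/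
theorem le_one_of_degD_eq_one {V : Type*} [Fintype V] {E : V → ℤ} (hE : Effective E)
    (hd : degD E = 1) (v : V) : E v ≤ 1 :=
  hd ▸ Finset.single_le_sum (f := E) (fun u _ => hE u) (Finset.mem_univ v)

theorem eq_zero_of_degD_eq_one {V : Type*} [Fintype V] {E : V → ℤ} (hE : Effective E)
    (hd : degD E = 1) {v w : V} (hvw : v ≠ w) (hw : E w ≠ 0) : E v = 0 := by
  classical
  have hle : ∑ u ∈ {v, w}, E u ≤ ∑ u, E u :=
    Finset.sum_le_univ_sum_of_nonneg hE
  rw [Finset.sum_pair hvw] at hle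
  have hv := hE v
  have hw' := hE w
  unfold degD at hd
  omega

theorem rook_adj {n m : ℕ} {v w : Fin n × Fin m} :
    (rook n m).Adj v w ↔ v.1 ≠ w.1 ∧ v.2 = w.2 ∨ v.2 ≠ w.2 ∧ v.1 = w.1 := by
  simp [rook, SimpleGraph.boxProd_adj]

/-- A vertex outside a row has exactly one neighbour in that row. -/
theorem edgesTo_row_of_ne {n m : ℕ} {i₀ : Fin n} {v : Fin n × Fin m} (hv : v.1 ≠ i₀) :
    edgesTo (rook n m) v (Finset.univ.filter (fun u => u.1 ≠ i₀))ᶜ = 1 := by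
  rw [edgesTo, Finset.card_eq_one]
  refine ⟨(i₀, v.2), ?_⟩
  ext u
  simp only [Finset.mem_filter, Finset.mem_compl, Finset.mem_univ, true_and, not_not, rook_adj,
    Finset.mem_singleton, Prod.ext_iff]
  grind

/-- A vertex of a row has a neighbour outside that row. -/
theorem one_le_edgesTo_compl_row {n m : ℕ} (hn : 2 ≤ n) {i₀ : Fin n} {v : Fin n × Fin m}
    (hv : v.1 = i₀) :
    1 ≤ edgesTo (rook n m) v (Finset.univ.filter (fun u => u.1 ≠ i₀)) := by
  have : Nontrivial (Fin n) := Fin.nontrivial_iff_two_le.mpr hn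
  obtain ⟨i, hi⟩ := exists_ne i₀
  refine Finset.card_pos.mpr ⟨(i, v.2), ?_⟩
  simp [rook_adj, hv, hi, hi.symm]

theorem degD_row_divisor (n m : ℕ) (i₀ : Fin n) :
    degD (fun v : Fin n × Fin m => if v.1 = i₀ then 0 else 1) = ((n - 1) * m : ℕ) := by
  have hn : 1 ≤ n := i₀.pos
  rw [degD, Fintype.sum_prod_type_right]
  simp [Finset.sum_ite, Finset.filter_ne', Finset.card_erase_of_mem, Nat.cast_sub hn]
  ring

theorem rankGE_one_row_divisor {n : ℕ} (m : ℕ) (hn : 2 ≤ n) (i₀ : Fin n) :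
    RankGE (rook n m) (fun v : Fin n × Fin m => if v.1 = i₀ then 0 else 1) 1 := by
  intro E hE hd
  rw [Nat.cast_one] at hd
  by_cases h : ∃ w : Fin n × Fin m, w.1 = i₀ ∧ E w ≠ 0
  · obtain ⟨w, hw, hEw⟩ := h
    refine ⟨_, .single ⟨Finset.univ.filter (fun u => u.1 ≠ i₀), rfl⟩, fun v => ?_⟩
    by_cases hv : v.1 = i₀
    · have h₁ := one_le_edgesTo_compl_row hn hv
      have h₂ := le_one_of_degD_eq_one hE hd v
      simp only [fire, Finset.mem_filter, hv, Pi.sub_apply]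
      simp only [ne_eq, not_true_eq_false, and_false, if_true, if_false] at h₁ ⊢
      omega
    · have h₁ := edgesTo_row_of_ne hv
      have h₂ : E v = 0 := eq_zero_of_degD_eq_one hE hd (fun h => hv (h ▸ hw)) hEw
      simp only [fire, Finset.mem_filter, Finset.mem_univ, ne_eq, hv, Pi.sub_apply, h₂]
      simp only [ne_eq] at h₁
      rw [if_pos ⟨trivial, not_false⟩, h₁]
      simp
  · push Not at h
    refine ⟨_, .refl, fun v => ?_⟩
    by_cases hv : v.1 = i₀
    · simp [hv, h v hv]
    · simpa [hv] using le_one_of_degD_eq_one hE hd v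

/-- The divisor on `K_n □ K_m` placing one chip on every vertex outside a fixed row and
no chips on that row has degree `(n - 1) * m` and rank at least one; hence
`gon(K_n □ K_m) ≤ (n - 1) * m`. -/
theorem rook_row_divisor_positive_rank (n m : ℕ) (hn : 2 ≤ n) (hnm : n ≤ m) (i₀ : Fin n) :
    degD (fun v : Fin n × Fin m => if v.1 = i₀ then 0 else 1) = ((n - 1) * m : ℕ) ∧
    RankGE (rook n m) (fun v : Fin n × Fin m => if v.1 = i₀ then 0 else 1) 1 ∧
    gonality (rook n m) ≤ (n - 1) * m := by
  exact ⟨degD_row_divisor n m i₀, rankGE_one_row_divisor m hn i₀,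
    Nat.sInf_le ⟨_, rankGE_one_row_divisor m hn i₀, degD_row_divisor n m i₀⟩⟩
end

section
/- Let G be a finite connected graph, let v be a vertex of G, and let D be a divisor on G that is v-reduced and satisfies D(v) ≤ 0. Then D does not have positive rank. -/
/-- A divisor is effective away from `v` if all its values except possibly at `v`
are nonnegative. -/
def EffectiveAwayFrom {V : Type*} (D : V → ℤ) (v : V) : Prop := ∀ u, u ≠ v → 0 ≤ D u

/-- A divisor is `v`-reduced if it is effective away from `v` and firing any nonempty
subset of vertices avoiding `v` results in a divisor that is not effective away from `v`. -/
def Reduced {V : Type*} [Fintype V] [DecidableEq V] (G : SimpleGraph V) [DecidableRel G.Adj]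
    (D : V → ℤ) (v : V) : Prop :=
  EffectiveAwayFrom D v ∧
    ∀ A : Finset V, A.Nonempty → v ∉ A → ¬ EffectiveAwayFrom (fire G D A) v

/-- The number of edges from `u` to `A`, as a sum over the vertices of the graph. -/
theorem edgesTo_eq_sum {V : Type*} [Fintype V] [DecidableEq V] (G : SimpleGraph V)
    [DecidableRel G.Adj] (u : V) (A : Finset V) :
    (edgesTo G u A : ℤ) = ∑ w, if G.Adj u w then (if w ∈ A then 1 else 0) else 0 := by
  simp only [edgesTo, Finset.card_filter, Nat.cast_sum, Nat.cast_ite, Nat.cast_one, Nat.cast_zero]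
  rw [← Finset.sum_subset (Finset.subset_univ A) (by intro w _ hw; simp [hw])]
  exact Finset.sum_congr rfl fun w hw => by simp [hw]

/-- Firing `A` subtracts the graph Laplacian of the indicator function of `A`. -/
theorem fire_eq_sub_laplacian {V : Type*} [Fintype V] [DecidableEq V] (G : SimpleGraph V)
    [DecidableRel G.Adj] (D : V → ℤ) (A : Finset V) (u : V) :
    fire G D A u = D u - ∑ w, if G.Adj u w then
      (if u ∈ A then (1 : ℤ) else 0) - (if w ∈ A then 1 else 0) else 0 := by
  by_cases hu : u ∈ A
  · simp only [fire, hu, if_true, edgesTo_eq_sum]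
    congr 1
    refine Finset.sum_congr rfl fun w _ => ?_
    by_cases hw : w ∈ A <;> simp [hw]
  · simp only [fire, hu, if_false, edgesTo_eq_sum]
    rw [sub_eq_add_neg, ← Finset.sum_neg_distrib]
    congr 1
    refine Finset.sum_congr rfl fun w _ => ?_
    by_cases hw : w ∈ A <;> by_cases ha : G.Adj u w <;> simp [hw, ha]

/-- Equivalent divisors differ by the graph Laplacian of an integer-valued function. -/
theorem LinEquiv.exists_laplacian {V : Type*} [Fintype V] [DecidableEq V] {G : SimpleGraph V}
    [DecidableRel G.Adj] {D D' : V → ℤ} (h : LinEquiv G D D') :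
    ∃ f : V → ℤ, ∀ u, D' u = D u - ∑ w, if G.Adj u w then f u - f w else 0 := by
  induction h with
  | refl => exact ⟨0, fun u => by simp⟩
  | tail _ hstep ih =>
    obtain ⟨f, hf⟩ := ih
    obtain ⟨A, rfl⟩ := hstep
    refine ⟨fun u => f u + if u ∈ A then 1 else 0, fun u => ?_⟩
    rw [fire_eq_sub_laplacian, hf u, sub_sub, ← Finset.sum_add_distrib]
    congr 1
    refine Finset.sum_congr rfl fun w _ => ?_
    by_cases hw : G.Adj u w
    · simp only [hw, if_true]
      ring
    · simp [hw]

/-- If a divisor `D` on a finite connected graph is `v`-reduced and `D v ≤ 0`,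
then `D` does not have positive rank. -/
theorem reduced_not_positive_rank {V : Type*} [Fintype V] [DecidableEq V]
    (G : SimpleGraph V) [DecidableRel G.Adj] (hG : G.Connected)
    (D : V → ℤ) (v : V) (hred : Reduced G D v) (hv : D v ≤ 0) :
    ¬ RankGE G D 1 := by
  intro hrank
  obtain ⟨D', hequiv, heff⟩ := hrank (Pi.single v 1)
    (fun u => by by_cases h : u = v <;> simp [h])
    (by simp [degD])
  obtain ⟨f, hf⟩ := hequiv.exists_laplacian
  obtain ⟨m, -, hm⟩ := Finset.exists_max_image Finset.univ f ⟨v, Finset.mem_univ v⟩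
  have hmax : ∀ w, f w ≤ f m := fun w => hm w (Finset.mem_univ w)
  have hvm : f v ≠ f m := by
    intro hvm
    have hsum : 0 ≤ ∑ w, if G.Adj v w then f v - f w else 0 :=
      Finset.sum_nonneg fun w _ => by
        have := hmax w
        split_ifs <;> omega
    have hD' := hf v
    simp only [Pi.sub_apply, Pi.single_eq_same] at hD'
    have := heff v
    omega
  refine hred.2 (Finset.univ.filter fun u => f u = f m) ⟨m, by simp⟩ (by simpa using hvm) ?_
  intro u huv
  by_cases hu : f u = f m
  · rw [fire_eq_sub_laplacian]
    have hD' := hf u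
    simp only [Pi.sub_apply, Pi.single_eq_of_ne huv, sub_zero] at hD'
    refine (heff u).trans (hD'.trans_le (sub_le_sub_left (Finset.sum_le_sum fun w _ => ?_) _))
    have := hmax w
    simp only [Finset.mem_filter, Finset.mem_univ, true_and, hu, if_true]
    split_ifs <;> omega
  · have := hred.1 u huv
    simp only [fire, Finset.mem_filter, Finset.mem_univ, true_and, hu, if_false]
    positivity
end

section
/- Let D be an effective divisor on the complete graph K_n of degree at most n − 2, and let v be a vertex with D(v) = 0. Then for every nonempty subset A of V(K_n) ∖ {v}, there is a vertex u ∈ A with D(u) < #{edges from u to A^c}; equivalently, firing any nonempty subset of V(K_n) ∖ {v} produces a divisor that is not effective away from v, so D is v-reduced. (This is the statement that Dhar's fire started at a vertex with no chips burns all of K_n.) -/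
/-- In a complete graph, a vertex of `A` is joined to every vertex outside `A`. -/
theorem edgesTo_top_compl {V : Type*} [Fintype V] [DecidableEq V] {A : Finset V} {u : V}
    (hu : u ∈ A) : edgesTo (⊤ : SimpleGraph V) u Aᶜ = Aᶜ.card := by
  unfold edgesTo
  rw [Finset.filter_true_of_mem]
  intro w hw
  rw [SimpleGraph.top_adj]
  rintro rfl
  exact Finset.mem_compl.mp hw hu

/-- For an effective divisor of degree at most `|V| - 2` on a complete graph, every nonempty
proper vertex subset `A` contains a vertex with fewer chips than edges to `Aᶜ`. -/
theorem exists_mem_lt_edgesTo_top_compl {V : Type*} [Fintype V] [DecidableEq V] {D : V → ℤ}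
    (hD : Effective D) (hdeg : degD D ≤ (Fintype.card V : ℤ) - 2) {A : Finset V}
    (hA : A.Nonempty) {v : V} (hv : v ∉ A) :
    ∃ u ∈ A, D u < (edgesTo (⊤ : SimpleGraph V) u Aᶜ : ℤ) := by
  by_contra! h
  have hsum : (A.card : ℤ) * Aᶜ.card ≤ ∑ u ∈ A, D u := by
    rw [← nsmul_eq_mul]
    refine Finset.card_nsmul_le_sum _ _ _ fun u hu => ?_
    simpa only [edgesTo_top_compl hu] using h u hu
  have hle : ∑ u ∈ A, D u ≤ degD D :=
    Finset.sum_le_sum_of_subset_of_nonneg (Finset.subset_univ A) fun u _ _ => hD u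
  have hpos : (1 : ℤ) ≤ A.card := by exact_mod_cast hA.card_pos
  have hpos' : (1 : ℤ) ≤ Aᶜ.card := by
    exact_mod_cast Finset.card_pos.mpr ⟨v, Finset.mem_compl.mpr hv⟩
  have hcard : (A.card : ℤ) + Aᶜ.card = Fintype.card V := by
    exact_mod_cast Finset.card_add_card_compl A
  nlinarith [mul_nonneg (sub_nonneg.mpr hpos) (sub_nonneg.mpr hpos')]

/-- Firing a set containing a vertex with fewer chips than outgoing edges puts that vertex
in debt. -/
theorem not_effectiveAwayFrom_fire {V : Type*} [Fintype V] [DecidableEq V] {G : SimpleGraph V}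
    [DecidableRel G.Adj] {D : V → ℤ} {A : Finset V} {v : V} (hv : v ∉ A)
    (h : ∃ u ∈ A, D u < (edgesTo G u Aᶜ : ℤ)) : ¬ EffectiveAwayFrom (fire G D A) v := by
  obtain ⟨u, hu, hlt⟩ := h
  intro heff
  have := heff u fun huv => hv (huv ▸ hu)
  simp only [fire, if_pos hu] at this
  lia

/-- Dhar's fire started at a chipless vertex burns all of `K_n`: if `D` is an effective
divisor on `K_n` of degree at most `n - 2` and `D v = 0`, then every nonempty subset `A`
of vertices avoiding `v` contains a vertex with fewer chips than edges to `Aᶜ`;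
equivalently, firing any such subset produces a divisor that is not effective away
from `v`, so `D` is `v`-reduced. -/
theorem dhar_burns_complete_graph (n : ℕ) (D : Fin n → ℤ) (hD : Effective D)
    (hdeg : degD D ≤ (n : ℤ) - 2) (v : Fin n) (hv : D v = 0) :
    (∀ A : Finset (Fin n), A.Nonempty → v ∉ A →
      ∃ u ∈ A, D u < (edgesTo (⊤ : SimpleGraph (Fin n)) u Aᶜ : ℤ)) ∧
    (∀ A : Finset (Fin n), A.Nonempty → v ∉ A →
      ¬ EffectiveAwayFrom (fire (⊤ : SimpleGraph (Fin n)) D A) v) ∧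
    Reduced (⊤ : SimpleGraph (Fin n)) D v := by
  have hburn : ∀ A : Finset (Fin n), A.Nonempty → v ∉ A →
      ∃ u ∈ A, D u < (edgesTo (⊤ : SimpleGraph (Fin n)) u Aᶜ : ℤ) := fun A hA hvA =>
    exists_mem_lt_edgesTo_top_compl hD (by rwa [Fintype.card_fin]) hA hvA
  have hfire : ∀ A : Finset (Fin n), A.Nonempty → v ∉ A →
      ¬ EffectiveAwayFrom (fire (⊤ : SimpleGraph (Fin n)) D A) v := fun A hA hvA =>
    not_effectiveAwayFrom_fire hvA (hburn A hA hvA)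
  exact ⟨hburn, hfire, fun u _ => hD u, hfire⟩
end

section
/- Let 2 ≤ n ≤ m and let (A, B) be a partition of the vertex set of the rook graph K_n □ K_m into two parts with |A| ≥ n − 1 and |B| ≥ n − 1. Then the number of edges of K_n □ K_m with one endpoint in A and the other in B is at least (n − 1)·m. -/
/-- The number of edges with one endpoint in `A` and the other in `B`
(for disjoint `A`, `B` each such edge is counted exactly once). -/
def cutBetween {V : Type*} [Fintype V] [DecidableEq V] (G : SimpleGraph V) [DecidableRel G.Adj]
    (A B : Finset V) : ℕ :=
  (Finset.univ.filter (fun p : V × V => G.Adj p.1 p.2 ∧ p.1 ∈ A ∧ p.2 ∈ B)).card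

/-- The pairs in `A ×ˢ B` whose two entries have the same image under `f`. -/
def fiberPairs {V γ : Type*} [DecidableEq γ] (f : V → γ) (A B : Finset V) : Finset (V × V) :=
  (A ×ˢ B).filter fun p => f p.1 = f p.2

theorem card_mul_le_card_fiberPairs {V γ : Type*} [Fintype V] [DecidableEq V] [DecidableEq γ]
    (f : V → γ) {A B : Finset V} (hdisj : Disjoint A B) (hunion : A ∪ B = Finset.univ)
    {k : ℕ} (Y : Finset γ) (hk : ∀ y ∈ Y, (Finset.univ.filter fun v => f v = y).card = k)
    (hYA : ∀ y ∈ Y, ∃ a ∈ A, f a = y) (hYB : ∀ y ∈ Y, ∃ b ∈ B, f b = y) :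
    Y.card * (k - 1) ≤ (fiberPairs f A B).card := by
  have hfiber : ∀ y ∈ Y, k - 1 ≤
      ((A.filter fun v => f v = y) ×ˢ (B.filter fun v => f v = y)).card := by
    intro y hy
    obtain ⟨a, ha, hay⟩ := hYA y hy
    obtain ⟨b, hb, hby⟩ := hYB y hy
    have hApos : 0 < (A.filter fun v => f v = y).card :=
      Finset.card_pos.2 ⟨a, by simp [ha, hay]⟩
    have hBpos : 0 < (B.filter fun v => f v = y).card :=
      Finset.card_pos.2 ⟨b, by simp [hb, hby]⟩
    have hsum := hk y hy
    rw [← hunion, Finset.filter_union,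
      Finset.card_union_of_disjoint (Finset.disjoint_filter_filter hdisj)] at hsum
    rw [Finset.card_product, Nat.sub_le_iff_le_add, ← hsum]
    nlinarith
  calc Y.card * (k - 1) = ∑ y ∈ Y, (k - 1) := by simp
    _ ≤ ∑ y ∈ Y, ((A.filter fun v => f v = y) ×ˢ (B.filter fun v => f v = y)).card :=
      Finset.sum_le_sum hfiber
    _ = (Y.sigma fun y => (A.filter fun v => f v = y) ×ˢ (B.filter fun v => f v = y)).card :=
      (Finset.card_sigma _ _).symm
    _ ≤ (fiberPairs f A B).card := by
      refine Finset.card_le_card_of_injOn (fun q => q.2) ?_ ?_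
      · rintro ⟨y, a, b⟩ h
        simp only [Finset.coe_sigma, Set.mem_sigma_iff, Finset.mem_coe, Finset.mem_product,
          Finset.mem_filter, fiberPairs] at h ⊢
        grind
      · rintro ⟨y, a, b⟩ h ⟨y', a', b'⟩ h' heq
        simp only [Finset.coe_sigma, Set.mem_sigma_iff, Finset.mem_coe, Finset.mem_product,
          Finset.mem_filter] at h h' heq
        grind

theorem cutBetween_comm {V : Type*} [Fintype V] [DecidableEq V] (G : SimpleGraph V)
    [DecidableRel G.Adj] (A B : Finset V) : cutBetween G A B = cutBetween G B A := by
  refine Finset.card_bij' (fun p _ => p.swap) (fun p _ => p.swap) ?_ ?_ ?_ ?_ <;>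
    simp +contextual [G.adj_comm]

theorem cutBetween_rook {n m : ℕ} {A B : Finset (Fin n × Fin m)} (hdisj : Disjoint A B) :
    cutBetween (rook n m) A B =
      (fiberPairs Prod.fst A B).card + (fiberPairs Prod.snd A B).card := by
  have hne : ∀ a ∈ A, ∀ b ∈ B, a ≠ b := fun a ha b hb h =>
    Finset.disjoint_left.1 hdisj ha (h ▸ hb)
  rw [← Finset.card_union_of_disjoint]
  · unfold cutBetween
    congr 1
    ext ⟨⟨x, y⟩, ⟨x', y'⟩⟩
    simp only [rook, SimpleGraph.boxProd_adj, SimpleGraph.top_adj, fiberPairs, Finset.mem_filter,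
      Finset.mem_univ, Finset.mem_union, Finset.mem_product]
    grind
  · rw [Finset.disjoint_left]
    rintro ⟨⟨x, y⟩, ⟨x', y'⟩⟩ h h'
    simp only [fiberPairs, Finset.mem_filter, Finset.mem_product] at h h'
    grind

/-- If `P` is a set of columns contained in `A`, then every vertex of `B` shares its row with a
vertex of each column in `P`. -/
theorem card_mul_card_le_card_fiberPairs_fst {α β : Type*} [DecidableEq α]
    {A B : Finset (α × β)} {P : Finset β} (hP : ∀ y ∈ P, ∀ x, (x, y) ∈ A) :
    P.card * B.card ≤ (fiberPairs Prod.fst A B).card := by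
  rw [← Finset.card_product]
  refine Finset.card_le_card_of_injOn (fun q => ((q.2.1, q.1), q.2)) ?_ ?_
  · rintro ⟨y, b⟩ h
    simp only [Finset.mem_coe, Finset.mem_product, fiberPairs, Finset.mem_filter] at h ⊢
    exact ⟨⟨hP y h.1 _, h.2⟩, trivial⟩
  · rintro ⟨y, b⟩ _ ⟨y', b'⟩ _ heq
    simp only [Prod.mk.injEq] at heq ⊢
    exact ⟨heq.1.2, heq.2⟩

theorem card_filter_snd_eq {n m : ℕ} (y : Fin m) :
    (Finset.univ.filter fun v : Fin n × Fin m => v.2 = y).card = n := by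
  have : (Finset.univ.filter fun v : Fin n × Fin m => v.2 = y) = Finset.univ ×ˢ {y} := by
    ext ⟨x, z⟩; simp [eq_comm]
  simp [this]

theorem card_filter_fst_eq {n m : ℕ} (x : Fin n) :
    (Finset.univ.filter fun v : Fin n × Fin m => v.1 = x).card = m := by
  have : (Finset.univ.filter fun v : Fin n × Fin m => v.1 = x) = {x} ×ˢ Finset.univ := by
    ext ⟨z, y⟩; simp [eq_comm]
  simp [this]

/-- The cut bound when every column meets `A`. -/
theorem le_cutBetween_rook_of_columns_meet {n m : ℕ} {A B : Finset (Fin n × Fin m)}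
    (hdisj : Disjoint A B) (hunion : A ∪ B = Finset.univ) (hB : n - 1 ≤ B.card)
    (hcol : ∀ y, ∃ x, (x, y) ∈ A) :
    (n - 1) * m ≤ cutBetween (rook n m) A B := by
  set P : Finset (Fin m) := Finset.univ.filter fun y => ∀ x, (x, y) ∈ A with hPdef
  have hrow : P.card * B.card ≤ (fiberPairs Prod.fst A B).card :=
    card_mul_card_le_card_fiberPairs_fst fun y hy => (Finset.mem_filter.1 hy).2
  have hcols : Pᶜ.card * (n - 1) ≤ (fiberPairs Prod.snd A B).card := by
    refine card_mul_le_card_fiberPairs Prod.snd hdisj hunion _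
      (fun y _ => card_filter_snd_eq y) (fun y _ => ?_) fun y hy => ?_
    · obtain ⟨x, hx⟩ := hcol y
      exact ⟨_, hx, rfl⟩
    · simp only [hPdef, Finset.mem_compl, Finset.mem_filter, Finset.mem_univ, true_and,
        not_forall] at hy
      obtain ⟨x, hx⟩ := hy
      have hmem : (x, y) ∈ A ∪ B := hunion ▸ Finset.mem_univ _
      exact ⟨_, (Finset.mem_union.1 hmem).resolve_left hx, rfl⟩
  have hcard : P.card + Pᶜ.card = m := by simp
  rw [cutBetween_rook hdisj]
  calc (n - 1) * m = P.card * (n - 1) + Pᶜ.card * (n - 1) := by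
        rw [← add_mul, hcard, mul_comm]
    _ ≤ _ := add_le_add ((Nat.mul_le_mul_left _ hB).trans hrow) hcols

/-- Any partition `(A, B)` of the vertices of `K_n □ K_m` (for `2 ≤ n ≤ m`) with
`|A| ≥ n - 1` and `|B| ≥ n - 1` has at least `(n - 1) * m` edges across it. -/
theorem rook_cut_bound (n m : ℕ) (hn : 2 ≤ n) (hnm : n ≤ m)
    (A B : Finset (Fin n × Fin m)) (hdisj : Disjoint A B) (hunion : A ∪ B = Finset.univ)
    (hA : n - 1 ≤ A.card) (hB : n - 1 ≤ B.card) :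
    (n - 1) * m ≤ cutBetween (rook n m) A B := by
  by_cases hcolA : ∀ y, ∃ x, (x, y) ∈ A
  · exact le_cutBetween_rook_of_columns_meet hdisj hunion hB hcolA
  by_cases hcolB : ∀ y, ∃ x, (x, y) ∈ B
  · rw [cutBetween_comm]
    exact le_cutBetween_rook_of_columns_meet hdisj.symm (Finset.union_comm B A ▸ hunion) hA hcolB
  push Not at hcolA hcolB
  obtain ⟨y, hy⟩ := hcolA
  obtain ⟨z, hz⟩ := hcolB
  have hmem : ∀ v, v ∈ A ∨ v ∈ B := fun v => Finset.mem_union.1 (hunion ▸ Finset.mem_univ v)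
  have hrows : (Finset.univ : Finset (Fin n)).card * (m - 1) ≤ (fiberPairs Prod.fst A B).card :=
    card_mul_le_card_fiberPairs Prod.fst hdisj hunion _ (fun x _ => card_filter_fst_eq x)
      (fun x _ => ⟨(x, z), (hmem _).resolve_right (hz x), rfl⟩)
      fun x _ => ⟨(x, y), (hmem _).resolve_left (hy x), rfl⟩
  rw [Finset.card_univ, Fintype.card_fin] at hrows
  rw [cutBetween_rook hdisj]
  refine le_trans ?_ (hrows.trans (Nat.le_add_right _ _))
  rw [Nat.sub_mul, Nat.mul_sub, one_mul, mul_one]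
  exact Nat.sub_le_sub_left hnm _
end

section
/- For all m ≥ 2, the scramble number of the rook graph K_2 □ K_m equals m (and hence equals its gonality). -/
/-- A scramble on `G`: a collection of nonempty vertex subsets (eggs), each of which
induces a connected subgraph. -/
def IsScramble {V : Type*} (G : SimpleGraph V) (S : Set (Finset V)) : Prop :=
  ∀ E ∈ S, E.Nonempty ∧ (G.induce (E : Set V)).Connected

/-- A hitting set of a scramble: a vertex set intersecting every egg. -/
def IsHittingSet {V : Type*} [DecidableEq V] (S : Set (Finset V)) (H : Finset V) : Prop :=
  ∀ E ∈ S, (E ∩ H).Nonempty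

/-- The number of edges with one endpoint in `X` and the other outside `X`. -/
def cutSize {V : Type*} [Fintype V] [DecidableEq V] (G : SimpleGraph V) [DecidableRel G.Adj]
    (X : Finset V) : ℕ :=
  (Finset.univ.filter (fun p : V × V => G.Adj p.1 p.2 ∧ p.1 ∈ X ∧ p.2 ∉ X)).card

/-- The partition `(X, Xᶜ)` is an egg cut of `S` if some egg is contained in `X` and
some egg is contained in `Xᶜ`. -/
def IsEggCut {V : Type*} [Fintype V] [DecidableEq V] (S : Set (Finset V)) (X : Finset V) : Prop :=
  (∃ E ∈ S, E ⊆ X) ∧ (∃ E ∈ S, E ⊆ Xᶜ)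

/-- The order of a scramble: the minimum of the minimal hitting set size and the minimal
egg cut-set size (`⊤` if no hitting set/egg cut exists). -/
noncomputable def scrambleOrder {V : Type*} [Fintype V] [DecidableEq V] (G : SimpleGraph V)
    [DecidableRel G.Adj] (S : Set (Finset V)) : ℕ∞ :=
  min (sInf {k : ℕ∞ | ∃ H : Finset V, IsHittingSet S H ∧ (H.card : ℕ∞) = k})
      (sInf {k : ℕ∞ | ∃ X : Finset V, IsEggCut S X ∧ (cutSize G X : ℕ∞) = k})

/-- The scramble number of a graph: the maximum order of a scramble on it. -/
noncomputable def scrambleNumber {V : Type*} [Fintype V] [DecidableEq V] (G : SimpleGraph V)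
    [DecidableRel G.Adj] : ℕ∞ :=
  sSup {k : ℕ∞ | ∃ S : Set (Finset V), IsScramble G S ∧ scrambleOrder G S = k}

theorem exists_adj_of_connected_induce {V : Type*} {G : SimpleGraph V} {E A : Finset V}
    (hE : (G.induce (E : Set V)).Connected)
    {a b : V} (ha : a ∈ E) (hb : b ∈ E) (haA : a ∈ A) (hbA : b ∉ A) :
    ∃ x ∈ E, ∃ y ∈ E, G.Adj x y ∧ x ∈ A ∧ y ∉ A := by
  obtain ⟨p⟩ := hE.preconnected ⟨a, ha⟩ ⟨b, hb⟩
  obtain ⟨d, -, hd₁, hd₂⟩ := p.exists_boundary_dart {x | x.1 ∈ A} haA hbA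
  exact ⟨d.fst, d.fst.2, d.snd, d.snd.2, d.adj, hd₁, hd₂⟩

theorem Effective.le_degD {V : Type*} [Fintype V] {D : V → ℤ} (hD : Effective D) (v : V) :
    D v ≤ degD D :=
  Finset.single_le_sum (fun u _ => hD u) (Finset.mem_univ v)

theorem Effective.card_support_le_degD {V : Type*} [Fintype V] {D : V → ℤ} (hD : Effective D) :
    (({v | 0 < D v} : Finset V).card : ℤ) ≤ degD D := by
  rw [← Finset.sum_boole]
  refine Finset.sum_le_sum fun v _ => ?_
  have := hD v
  split_ifs <;> omega

section ChipFiring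

variable {V : Type*} [Fintype V] (G : SimpleGraph V) [DecidableRel G.Adj]

/-- The graph Laplacian acting on integer-valued functions. -/
def laplacian (f : V → ℤ) : V → ℤ := fun v => ∑ u with G.Adj v u, (f v - f u)

theorem laplacian_add (f g : V → ℤ) : laplacian G (f + g) = laplacian G f + laplacian G g := by
  funext v
  simp only [laplacian, Pi.add_apply, ← Finset.sum_add_distrib]
  exact Finset.sum_congr rfl fun u _ => by ring

theorem laplacian_neg (f : V → ℤ) : laplacian G (-f) = -laplacian G f := by
  funext v
  simp only [laplacian, Pi.neg_apply, ← Finset.sum_neg_distrib]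
  exact Finset.sum_congr rfl fun u _ => by ring

theorem laplacian_sub (f g : V → ℤ) : laplacian G (f - g) = laplacian G f - laplacian G g := by
  rw [sub_eq_add_neg, laplacian_add, laplacian_neg, sub_eq_add_neg]

theorem laplacian_const (c : ℤ) : laplacian G (fun _ => c) = 0 := by
  funext v
  simp [laplacian]

theorem sum_laplacian (f : V → ℤ) : ∑ v, laplacian G f v = 0 := by
  have h : ∑ v, laplacian G f v = -∑ v, laplacian G f v := by
    simp only [laplacian, Finset.sum_filter]
    conv_lhs => rw [Finset.sum_comm]
    simp only [← Finset.sum_neg_distrib]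
    refine Finset.sum_congr rfl fun v _ => Finset.sum_congr rfl fun u _ => ?_
    by_cases huv : G.Adj u v
    · simp [huv, huv.symm]
    · simp [huv, mt SimpleGraph.Adj.symm huv]
  linarith

theorem sub_laplacian_le_sub_laplacian_max (D f : V → ℤ) {c : ℤ} {v : V} (hv : c ≤ f v) :
    (D - laplacian G f) v ≤ (D - laplacian G fun v => max (f v) c) v := by
  simp only [Pi.sub_apply, laplacian]
  have : ∑ u with G.Adj v u, (max (f v) c - max (f u) c) ≤ ∑ u with G.Adj v u, (f v - f u) :=
    Finset.sum_le_sum fun u _ => by omega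
  omega

theorem degD_sub_laplacian (D f : V → ℤ) : degD (D - laplacian G f) = degD D := by
  simp [degD, Finset.sum_sub_distrib, sum_laplacian]

/-- Truncating a firing script from below keeps the resulting divisor effective. -/
theorem effective_sub_laplacian_max {D f : V → ℤ} (hD : Effective D)
    (hD' : Effective (D - laplacian G f)) (c : ℤ) :
    Effective (D - laplacian G fun v => max (f v) c) := by
  intro v
  have h₁ := hD v
  have h₂ := hD' v
  simp only [Pi.sub_apply, laplacian] at h₂ ⊢
  rcases le_total (f v) c with hv | hv
  · have : ∑ u with G.Adj v u, (max (f v) c - max (f u) c) ≤ 0 :=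
      Finset.sum_nonpos fun u _ => by omega
    omega
  · have : ∑ u with G.Adj v u, (max (f v) c - max (f u) c) ≤ ∑ u with G.Adj v u, (f v - f u) :=
      Finset.sum_le_sum fun u _ => by omega
    omega

variable [DecidableEq V]

theorem fire_eq_sub_laplacian_s5 (D : V → ℤ) (A : Finset V) :
    fire G D A = D - laplacian G (fun v => if v ∈ A then 1 else 0) := by
  funext v
  by_cases hv : v ∈ A
  · have h : ∀ u, (1 : ℤ) - (if u ∈ A then 1 else 0) = if u ∈ Aᶜ then 1 else 0 := by
      intro u; by_cases hu : u ∈ A <;> simp [hu]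
    simp only [fire, laplacian, edgesTo, hv, if_true, Pi.sub_apply, h, Finset.sum_boole,
      Finset.filter_filter]
    congr 3
    ext u; simp [and_comm]
  · have h : ∀ u, (0 : ℤ) - (if u ∈ A then 1 else 0) = -(if u ∈ A then 1 else 0) := by
      intro u; ring
    simp only [fire, laplacian, edgesTo, hv, if_false, Pi.sub_apply, h, Finset.sum_boole,
      Finset.filter_filter, Finset.sum_neg_distrib, sub_neg_eq_add]
    congr 3
    ext u; simp [and_comm]

variable {G} in
theorem LinEquiv.exists_eq_sub_laplacian {D D' : V → ℤ} (h : LinEquiv G D D') :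
    ∃ f, D' = D - laplacian G f := by
  induction h with
  | refl => exact ⟨fun _ => 0, by rw [laplacian_const, sub_zero]⟩
  | tail _ hstep ih =>
    obtain ⟨f, rfl⟩ := ih
    obtain ⟨A, rfl⟩ := hstep
    exact ⟨f + fun v => if v ∈ A then 1 else 0, by
      rw [fire_eq_sub_laplacian_s5, laplacian_add, sub_sub]⟩

theorem fire_sub_laplacian_max (D f : V → ℤ) (c : ℤ) :
    fire G (D - laplacian G fun v => max (f v) (c + 1)) {v | c < f v} =
      D - laplacian G fun v => max (f v) c := by
  have h : ((fun v => max (f v) (c + 1)) + fun v => if v ∈ ({v | c < f v} : Finset V) then 1 else 0)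
      = (fun v => max (f v) c) + fun _ => 1 := by
    funext v
    simp only [Pi.add_apply, Finset.mem_filter, Finset.mem_univ, true_and]
    split_ifs <;> omega
  rw [fire_eq_sub_laplacian_s5, sub_sub, ← laplacian_add, h, laplacian_add, laplacian_const, add_zero]

theorem cutSize_eq_sum (A : Finset V) : cutSize G A = ∑ v ∈ A, edgesTo G v Aᶜ := by
  simp only [edgesTo]
  rw [← Finset.card_sigma, cutSize]
  refine Finset.card_bij' (fun p _ => ⟨p.1, p.2⟩) (fun p _ => (p.1, p.2)) ?_ ?_ ?_ ?_ <;>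
    simp +contextual

variable {G}

theorem Effective.cutSize_le_degD {D : V → ℤ} (hD : Effective D) {A : Finset V}
    (h : Effective (fire G D A)) : (cutSize G A : ℤ) ≤ degD D := by
  rw [cutSize_eq_sum, Nat.cast_sum]
  calc ∑ v ∈ A, (edgesTo G v Aᶜ : ℤ) ≤ ∑ v ∈ A, D v := Finset.sum_le_sum fun v hv => by
        have := h v
        simp only [fire, hv, if_true] at this
        omega
    _ ≤ degD D := Finset.sum_le_sum_of_subset_of_nonneg (Finset.subset_univ A) fun v _ _ => hD v

theorem edgesTo_pos {V : Type*} [DecidableEq V] {G : SimpleGraph V} [DecidableRel G.Adj]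
    {v u : V} {A : Finset V} (hu : u ∈ A) (h : G.Adj v u) : 0 < edgesTo G v A :=
  Finset.card_pos.2 ⟨u, Finset.mem_filter.2 ⟨hu, h⟩⟩

/-- A connected set that loses all its chips when `A` is fired lies inside `A`. -/
theorem subset_of_fire_eq_zero {D : V → ℤ} (hD : Effective D) {A E : Finset V}
    (hE : (G.induce (E : Set V)).Connected) {v : V} (hv : v ∈ E) (hpos : 0 < D v)
    (hzero : ∀ u ∈ E, fire G D A u ≤ 0) : E ⊆ A := by
  have hvA : v ∈ A := by
    by_contra hvA
    have := hzero v hv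
    simp only [fire, hvA, if_false] at this
    omega
  intro w hw
  by_contra hwA
  obtain ⟨x, -, y, hy, hxy, hxA, hyA⟩ := exists_adj_of_connected_induce hE hv hw hvA hwA
  have h₁ := hzero y hy
  have h₂ := edgesTo_pos hxA hxy.symm
  have h₃ := hD y
  simp only [fire, hyA, if_false] at h₁
  omega

/-- A connected set without chips that contains a vertex outside a legally fired set `A` is
disjoint from `A`. -/
theorem subset_compl_of_fire_effective {D : V → ℤ} {A E : Finset V}
    (h : Effective (fire G D A)) (hE : (G.induce (E : Set V)).Connected)
    (hzero : ∀ u ∈ E, D u ≤ 0) {v : V} (hv : v ∈ E) (hvA : v ∉ A) : E ⊆ Aᶜ := by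
  intro w hw
  rw [Finset.mem_compl]
  intro hwA
  obtain ⟨x, hx, y, -, hxy, hxA, hyA⟩ := exists_adj_of_connected_induce hE hw hv hwA hvA
  have h₁ := hzero x hx
  have h₂ := edgesTo_pos (Finset.mem_compl.2 hyA) hxy
  have h₃ := h x
  simp only [fire, hxA, if_true] at h₃
  omega

theorem RankGE.exists_effective_pos {D : V → ℤ} (h : RankGE G D 1) (v : V) :
    ∃ f, Effective (D - laplacian G f) ∧ 0 < (D - laplacian G f) v := by
  obtain ⟨D', hD', heff⟩ := h (Pi.single v 1)
    (fun u => by by_cases hu : u = v <;> simp [hu]) (by simp [degD])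
  obtain ⟨f, rfl⟩ := hD'.exists_eq_sub_laplacian
  refine ⟨f, fun u => ?_, ?_⟩
  · have := heff u
    by_cases hu : u = v <;> simp [hu] at this ⊢ <;> omega
  · have := heff v
    simp at this ⊢
    omega

theorem RankGE.exists_hittingSet_or_eggCut {D : V → ℤ} (hD : RankGE G D 1)
    {S : Set (Finset V)} (hS : IsScramble G S) :
    (∃ H, IsHittingSet S H ∧ (H.card : ℤ) ≤ degD D) ∨
      ∃ X, IsEggCut S X ∧ (cutSize G X : ℤ) ≤ degD D := by
  rcases isEmpty_or_nonempty V with hV | ⟨⟨v₀⟩⟩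
  · refine Or.inl ⟨∅, fun E hE => ?_, by simp [degD]⟩
    obtain ⟨v, -⟩ := (hS E hE).1
    exact hV.elim v
  let hits : (V → ℤ) → Set (Finset V) := fun D' => {E ∈ S | ∃ v ∈ E, 0 < D' v}
  obtain ⟨g₀, hg₀, -⟩ := hD.exists_effective_pos v₀
  obtain ⟨D₀, ⟨hD₀, f₀, hf₀⟩, hmax⟩ := Set.Finite.exists_maximalFor' hits
    {D' | Effective D' ∧ ∃ f, D' = D - laplacian G f} (Set.toFinite _) ⟨_, hg₀, g₀, rfl⟩
  have hdeg (f : V → ℤ) : degD (D₀ - laplacian G f) = degD D := by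
    rw [degD_sub_laplacian, hf₀, degD_sub_laplacian]
  have hmax' (f : V → ℤ) (hf : Effective (D₀ - laplacian G f))
      (hle : hits D₀ ⊆ hits (D₀ - laplacian G f)) : hits (D₀ - laplacian G f) ⊆ hits D₀ :=
    hmax (j := D₀ - laplacian G f)
      ⟨hf, f₀ + f, by rw [laplacian_add, hf₀, sub_sub]⟩ hle
  by_cases hhit : IsHittingSet S ({v | 0 < D₀ v} : Finset V)
  · refine Or.inl ⟨_, hhit, ?_⟩
    have := hD₀.card_support_le_degD
    rwa [hf₀, degD_sub_laplacian, ← hf₀] at this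
  right
  simp only [IsHittingSet, not_forall] at hhit
  obtain ⟨E, hES, hE⟩ := hhit
  have hE₀ : E ∉ hits D₀ := fun ⟨_, v, hv, hpos⟩ => hE ⟨v, by simp [hv, hpos]⟩
  obtain ⟨v, hv⟩ := (hS E hES).1
  obtain ⟨g, hg, hgv⟩ := hD.exists_effective_pos v
  obtain ⟨f, hf⟩ : ∃ f, D - laplacian G g = D₀ - laplacian G f :=
    ⟨g - f₀, by rw [laplacian_sub, hf₀]; abel⟩
  rw [hf] at hg hgv
  have heff := effective_sub_laplacian_max G hD₀ hg
  obtain ⟨c, hc₁, hc₂⟩ : ∃ c : ℤ, hits D₀ ⊆ hits (D₀ - laplacian G fun v => max (f v) (c + 1)) ∧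
      ¬ hits D₀ ⊆ hits (D₀ - laplacian G fun v => max (f v) c) := by
    by_contra! hcon
    obtain ⟨M, hM⟩ := (Set.finite_range f).bddAbove
    obtain ⟨N, hN⟩ := (Set.finite_range f).bddBelow
    have hMv (v : V) : f v ≤ M := hM ⟨v, rfl⟩
    have hNv (v : V) : N ≤ f v := hN ⟨v, rfl⟩
    have hall : ∀ c ≤ M, hits D₀ ⊆ hits (D₀ - laplacian G fun v => max (f v) c) := by
      intro c hc
      induction c, hc using Int.leInductionDown with
      | base => simp only [max_eq_right (hMv _), laplacian_const, sub_zero, subset_refl]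
      | pred c _ ih => exact hcon (c - 1) (by simpa using ih)
    have hN' := hall N ((hNv v).trans (hMv v))
    simp only [max_eq_left (hNv _)] at hN'
    exact hE₀ (hmax' f hg hN' ⟨hES, v, hv, hgv⟩)
  have hfire := fire_sub_laplacian_max G D₀ f c
  have hcut := (heff (c + 1)).cutSize_le_degD (hfire ▸ heff c)
  rw [hdeg] at hcut
  refine ⟨_, ⟨?_, E, hES, ?_⟩, hcut⟩
  · obtain ⟨E', hE', hE'c⟩ := Set.not_subset.1 hc₂
    obtain ⟨hE'S, u, hu, hupos⟩ := hc₁ hE'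
    refine ⟨E', hE'S, subset_of_fire_eq_zero (heff (c + 1)) (hS E' hE'S).2 hu hupos
      fun w hw => ?_⟩
    rw [hfire]
    exact not_lt.1 fun hpos => hE'c ⟨hE'S, w, hw, hpos⟩
  · have hzero (w) (hw : w ∈ E) : (D₀ - laplacian G fun v => max (f v) (c + 1)) w ≤ 0 :=
      not_lt.1 fun hpos => hE₀ (hmax' _ (heff (c + 1)) hc₁ ⟨hES, w, hw, hpos⟩)
    refine subset_compl_of_fire_effective (hfire ▸ heff c) (hS E hES).2 hzero hv fun hvA => ?_
    have := sub_laplacian_le_sub_laplacian_max G D₀ f (c := c + 1) (v := v) (by simpa using hvA)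
    have := hzero v hv
    omega

/-- A divisor of positive rank has degree at least the scramble number. -/
theorem scrambleNumber_le_of_rankGE {D : V → ℤ} (hD : RankGE G D 1) {d : ℕ} (hd : degD D = d) :
    scrambleNumber G ≤ d := by
  refine sSup_le ?_
  rintro _ ⟨S, hS, rfl⟩
  rcases hD.exists_hittingSet_or_eggCut hS with ⟨H, hH, hle⟩ | ⟨X, hX, hle⟩
  · exact (min_le_left _ _).trans <| (sInf_le (Set.mem_ofPred.2 ⟨H, hH, rfl⟩)).trans
      (by rw [hd] at hle; exact_mod_cast hle)
  · exact (min_le_right _ _).trans <| (sInf_le (Set.mem_ofPred.2 ⟨X, hX, rfl⟩)).trans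
      (by rw [hd] at hle; exact_mod_cast hle)

/-- If all nontrivial edge cuts have size at least `k`, and there are at least `k` vertices,
then the scramble number is at least `k`. -/
theorem le_scrambleNumber_of_le_cutSize {k : ℕ} (hk : k ≤ Fintype.card V)
    (h : ∀ X : Finset V, X.Nonempty → Xᶜ.Nonempty → k ≤ cutSize G X) :
    (k : ℕ∞) ≤ scrambleNumber G := by
  refine le_trans ?_ (le_sSup ⟨Set.range fun v : V => ({v} : Finset V), ?_, rfl⟩)
  · refine le_min (le_sInf ?_) (le_sInf ?_)
    · rintro _ ⟨H, hH, rfl⟩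
      have : H = Finset.univ := Finset.eq_univ_of_forall fun v => by
        obtain ⟨w, hw⟩ := hH {v} ⟨v, rfl⟩
        simp only [Finset.mem_inter, Finset.mem_singleton] at hw
        exact hw.1 ▸ hw.2
      subst this
      exact_mod_cast hk
    · rintro _ ⟨X, ⟨⟨_, ⟨v, rfl⟩, hv⟩, ⟨_, ⟨w, rfl⟩, hw⟩⟩, rfl⟩
      exact_mod_cast h X ⟨v, hv (by simp)⟩ ⟨w, hw (by simp)⟩
  · rintro _ ⟨v, rfl⟩
    refine ⟨Finset.singleton_nonempty v, ?_⟩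
    rw [Finset.coe_singleton]
    exact SimpleGraph.Connected.mk (SimpleGraph.Preconnected.of_subsingleton)

end ChipFiring

theorem rook_adj_s5 {n m : ℕ} {p q : Fin n × Fin m} :
    (rook n m).Adj p q ↔ p.1 ≠ q.1 ∧ p.2 = q.2 ∨ p.2 ≠ q.2 ∧ p.1 = q.1 := by
  simp [rook, SimpleGraph.boxProd_adj]

theorem le_cutSize_rook_of_mem_of_notMem {n m : ℕ} {X : Finset (Fin n × Fin m)} {i j : Fin n}
    (hij : i ≠ j) {a b : Fin m} (ha : (i, a) ∈ X) (hb : (j, b) ∉ X) :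
    m ≤ cutSize (rook n m) X := by
  let e : Fin m → (Fin n × Fin m) × (Fin n × Fin m) := fun k =>
    if (i, k) ∉ X then ((i, a), (i, k))
    else if (j, k) ∉ X then ((i, k), (j, k)) else ((j, k), (j, b))
  have he : Function.Injective e := by
    intro k l hkl
    simp only [e] at hkl
    split_ifs at hkl <;> simp_all
  have hmem (k : Fin m) : (rook n m).Adj (e k).1 (e k).2 ∧ (e k).1 ∈ X ∧ (e k).2 ∉ X := by
    simp only [e]
    split_ifs with h₁ h₂
    · have : k ≠ b := by rintro rfl; exact hb h₂
      simp_all [rook_adj_s5]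
    · simp_all [rook_adj_s5]
    · have : a ≠ k := by rintro rfl; exact h₁ ha
      simp_all [rook_adj_s5]
  calc m = (Finset.univ.image e).card := by
        rw [Finset.card_image_of_injective _ he, Finset.card_univ, Fintype.card_fin]
    _ ≤ _ := Finset.card_le_card fun p hp => by
        obtain ⟨k, -, rfl⟩ := Finset.mem_image.1 hp
        simpa using hmem k

theorem le_cutSize_rook {n m : ℕ} (hn : 2 ≤ n) {X : Finset (Fin n × Fin m)} (hX : X.Nonempty)
    (hX' : Xᶜ.Nonempty) : m ≤ cutSize (rook n m) X := by
  obtain ⟨⟨i, a⟩, ha⟩ := hX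
  obtain ⟨⟨j, b⟩, hb⟩ := hX'
  rw [Finset.mem_compl] at hb
  by_cases hij : i = j
  · subst hij
    have : Nontrivial (Fin n) := Fin.nontrivial_iff_two_le.2 hn
    obtain ⟨l, hl⟩ := exists_ne i
    by_cases hla : (l, a) ∈ X
    · exact le_cutSize_rook_of_mem_of_notMem hl hla hb
    · exact le_cutSize_rook_of_mem_of_notMem hl.symm ha hla
  · exact le_cutSize_rook_of_mem_of_notMem hij ha hb

theorem edgesTo_rook_two_compl_row (m : ℕ) (k : Fin m) (i : Fin 2) :
    edgesTo (rook 2 m) (i, k) {p | p.1 ≠ i} = 1 := by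
  rw [edgesTo, Finset.card_eq_one]
  refine ⟨(1 - i, k), ?_⟩
  ext ⟨j, l⟩
  simp only [Finset.mem_filter, Finset.mem_univ, true_and, rook_adj_s5, Finset.mem_singleton,
    Prod.mk.injEq]
  fin_cases i <;> fin_cases j <;> simp [eq_comm]

/-- One chip on each vertex of a row of `K_2 □ K_m` is a divisor of positive rank. -/
theorem rankGE_one_rook_two_row (m : ℕ) :
    RankGE (rook 2 m) (fun p => if p.1 = 0 then 1 else 0) 1 := by
  intro E hE hdeg
  by_cases h : ∀ k, E (1, k) ≤ 0
  · refine ⟨_, Relation.ReflTransGen.refl, ?_⟩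
    rintro ⟨i, k⟩
    have h₁ := hE.le_degD (i, k)
    have h₂ := h k
    fin_cases i <;> simp_all
  · push Not at h
    obtain ⟨k, hk⟩ := h
    have hother (p) (hp : p ≠ (1, k)) : E p ≤ 0 := by
      have := Finset.sum_le_sum_of_subset_of_nonneg (Finset.subset_univ {p, ((1 : Fin 2), k)})
        fun q _ _ => hE q
      rw [Finset.sum_pair hp] at this
      simp only [degD, Nat.cast_one] at hdeg
      omega
    let row : Finset (Fin 2 × Fin m) := Finset.univ.filter fun p => p.1 = 0
    refine ⟨_, Relation.ReflTransGen.single ⟨row, rfl⟩, ?_⟩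
    rintro ⟨i, l⟩
    have h₀ := edgesTo_rook_two_compl_row m l 0
    have h₁ := edgesTo_rook_two_compl_row m l 1
    have hE₁ := hE.le_degD (1, l)
    have hE₀ := hother (0, l) (by simp)
    have hrow : row = ({p | p.1 ≠ 1} : Finset (Fin 2 × Fin m)) := by
      ext ⟨j, _⟩; fin_cases j <;> simp [row]
    fin_cases i
    · simp [fire, row, Finset.compl_filter, h₀]
      simpa using hE₀
    · simp only [fire, hrow]
      simp [h₁] at hE₁ ⊢
      simp_all

theorem degD_rook_two_row (m : ℕ) :
    degD (fun p : Fin 2 × Fin m => if p.1 = 0 then (1 : ℤ) else 0) = m := by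
  rw [degD, Fintype.sum_prod_type]
  simp

/-- For all `m ≥ 2`, the scramble number of `K_2 □ K_m` equals `m`, and hence equals
its gonality. -/
theorem sn_rook_two (m : ℕ) (hm : 2 ≤ m) :
    scrambleNumber (rook 2 m) = (m : ℕ∞) ∧
    scrambleNumber (rook 2 m) = (gonality (rook 2 m) : ℕ∞) := by
  have hle : (m : ℕ∞) ≤ scrambleNumber (rook 2 m) :=
    le_scrambleNumber_of_le_cutSize (by simp; omega) fun X => le_cutSize_rook le_rfl
  have hge : scrambleNumber (rook 2 m) ≤ m :=
    scrambleNumber_le_of_rankGE (rankGE_one_rook_two_row m) (degD_rook_two_row m)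
  have hsn := le_antisymm hge hle
  refine ⟨hsn, hsn.trans ?_⟩
  have hmem : m ∈ {d : ℕ | ∃ D : Fin 2 × Fin m → ℤ, RankGE (rook 2 m) D 1 ∧ degD D = (d : ℤ)} :=
    ⟨_, rankGE_one_rook_two_row m, degD_rook_two_row m⟩
  have hgon : gonality (rook 2 m) = m := by
    refine le_antisymm (Nat.sInf_le hmem) (le_csInf ⟨m, hmem⟩ ?_)
    rintro d ⟨D, hD, hd⟩
    exact_mod_cast hle.trans (scrambleNumber_le_of_rankGE hD hd)
  rw [hgon]
end

section
/- Let 3 ≤ n ≤ m with m ≥ (n − 2)(n − 1). Then every subset A of the vertices of the rook graph K_n □ K_m with |A| = m + 1 contains a subset of size n − 1 that induces a connected subgraph of K_n □ K_m. -/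
/-- If no set of `k + 1` vertices of `A` induces a connected subgraph, then every vertex of `A`
has at most `k` vertices of `A` reachable from it inside `A`. -/
theorem exists_card_le_of_forall_not_connected {V : Type*} (G : SimpleGraph V)
    (A : Finset V) {k : ℕ} (hk : 1 ≤ k)
    (h : ∀ B ⊆ A, B.card = k + 1 → ¬ (G.induce (B : Set V)).Connected)
    (v : (A : Set V)) :
    ∃ B : Finset V, B.card ≤ k ∧
      ∀ w, (G.induce (A : Set V)).Reachable v w → (w : V) ∈ B := by
  classical
  let S := A.powerset.filter fun B : Finset V =>
    v.1 ∈ B ∧ B.card ≤ k ∧ (G.induce (B : Set V)).Connected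
  have mem_S (B : Finset V) : B ∈ S ↔
      B ⊆ A ∧ v.1 ∈ B ∧ B.card ≤ k ∧ (G.induce (B : Set V)).Connected := by
    simp [S]
  have hS : S.Nonempty := by
    refine ⟨{v.1}, (mem_S _).2 ⟨by simp, by simp, by simpa using hk, ?_⟩⟩
    rw [Finset.coe_singleton, SimpleGraph.induce_singleton_eq_top]
    exact SimpleGraph.connected_top
  obtain ⟨B, hB, hmax⟩ := S.exists_max_image Finset.card hS
  obtain ⟨hBA, hvB, hBk, hconn⟩ := (mem_S B).1 hB
  refine ⟨B, hBk, ?_⟩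
  have closed {u w : V} (hu : u ∈ B) (hw : w ∈ A) (huw : G.Adj u w) : w ∈ B := by
    by_contra hwB
    have hsub : insert w B ⊆ A := Finset.insert_subset hw hBA
    have hcard : (insert w B).card = B.card + 1 := Finset.card_insert_of_notMem hwB
    have hins : (G.induce ((insert w B : Finset V) : Set V)).Connected := by
      rw [Finset.coe_insert, Set.insert_eq]
      refine SimpleGraph.connected_induce_union ?_ hconn.preconnected
        (Set.mem_singleton w) (Finset.mem_coe.2 hu) huw.symm
      rw [SimpleGraph.induce_singleton_eq_top]
      exact SimpleGraph.preconnected_top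
    rcases hBk.lt_or_eq with hlt | heq
    · have := hmax _ ((mem_S _).2 ⟨hsub, Finset.mem_insert_of_mem hvB, by omega, hins⟩)
      omega
    · exact h _ hsub (by omega) hins
  intro w hw
  rw [SimpleGraph.reachable_iff_reflTransGen] at hw
  induction hw with
  | refl => exact hvB
  | @tail b c _ hbc ih => exact closed ih c.2 hbc

theorem rook_adj_of_fst_eq {n m : ℕ} {u v : Fin n × Fin m} (h : u.1 = v.1) (hne : u ≠ v) :
    (rook n m).Adj u v :=
  SimpleGraph.boxProd_adj.2 <| Or.inr ⟨fun h' => hne (Prod.ext h h'), h⟩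

theorem rook_adj_of_snd_eq {n m : ℕ} {u v : Fin n × Fin m} (h : u.2 = v.2) (hne : u ≠ v) :
    (rook n m).Adj u v :=
  SimpleGraph.boxProd_adj.2 <| Or.inl ⟨fun h' => hne (Prod.ext h' h), h⟩

/-- If the subgraph of `K_n □ K_m` induced by `A` has at least `n` components, then
`A` has at most one vertex in each column. -/
theorem card_le_of_le_card_connectedComponent {n m : ℕ} (A : Finset (Fin n × Fin m))
    (h : n ≤ Nat.card ((rook n m).induce (A : Set (Fin n × Fin m))).ConnectedComponent) :
    A.card ≤ m := by
  set H := (rook n m).induce (A : Set (Fin n × Fin m))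
  have comp_of_fst {u v : (A : Set (Fin n × Fin m))} (huv : u.1.1 = v.1.1) :
      H.connectedComponentMk u = H.connectedComponentMk v := by
    by_cases huv' : u = v
    · rw [huv']
    · exact SimpleGraph.ConnectedComponent.sound (SimpleGraph.Adj.reachable
        (rook_adj_of_fst_eq huv fun h' => huv' (Subtype.ext h')))
  have comp_of_snd {u v : (A : Set (Fin n × Fin m))} (huv : u.1.2 = v.1.2) :
      H.connectedComponentMk u = H.connectedComponentMk v := by
    by_cases huv' : u = v
    · rw [huv']
    · exact SimpleGraph.ConnectedComponent.sound (SimpleGraph.Adj.reachable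
        (rook_adj_of_snd_eq huv fun h' => huv' (Subtype.ext h')))
  let row : H.ConnectedComponent → Fin n := fun c => c.out.1.1
  have mk_out (c : H.ConnectedComponent) : H.connectedComponentMk c.out = c := Quot.out_eq c
  have row_inj : Function.Injective row := fun c d hcd => by
    rw [← mk_out c, ← mk_out d]
    exact comp_of_fst hcd
  have row_bij : Function.Bijective row :=
    row_inj.bijective_of_nat_card_le (by simpa using h)
  have row_mk (u : (A : Set (Fin n × Fin m))) : row (H.connectedComponentMk u) = u.1.1 := by
    obtain ⟨c, hc⟩ := row_bij.2 u.1.1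
    rw [← comp_of_fst hc, mk_out, hc]
  have inj : Set.InjOn Prod.snd (A : Set (Fin n × Fin m)) := fun u hu v hv huv => by
    refine Prod.ext ?_ huv
    have := congrArg row (comp_of_snd (u := ⟨u, hu⟩) (v := ⟨v, hv⟩) huv)
    rwa [row_mk, row_mk] at this
  simpa using Finset.card_le_card_of_injOn Prod.snd (t := Finset.univ) (by simp) inj

/-- For `3 ≤ n ≤ m` with `m ≥ (n - 2) * (n - 1)`, every set of `m + 1` vertices of
`K_n □ K_m` contains a subset of size `n - 1` inducing a connected subgraph. -/
theorem no_large_avoidance_set (n m : ℕ) (hn : 3 ≤ n) (hnm : n ≤ m)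
    (hm : (n - 2) * (n - 1) ≤ m) (A : Finset (Fin n × Fin m)) (hA : A.card = m + 1) :
    ∃ B ⊆ A, B.card = n - 1 ∧
      ((rook n m).induce (B : Set (Fin n × Fin m))).Connected := by
  classical
  by_contra hcon
  push Not at hcon
  set H := (rook n m).induce (A : Set (Fin n × Fin m))
  have fiber (v : (A : Set (Fin n × Fin m))) :=
    exists_card_le_of_forall_not_connected (rook n m) A (k := n - 2) (by omega)
      (fun B hB hc => hcon B hB (by omega)) v
  by_cases hc : n ≤ Nat.card H.ConnectedComponent
  · have := card_le_of_le_card_connectedComponent A hc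
    omega
  have hcard := Finset.card_le_mul_card_image_of_maps_to
    (s := (Finset.univ : Finset (A : Set (Fin n × Fin m)))) (t := Finset.univ)
    (f := H.connectedComponentMk) (by simp) (n - 2) fun c _ => by
      obtain ⟨v, rfl⟩ := c.exists_rep
      obtain ⟨B, hB, hmem⟩ := fiber v
      refine (Finset.card_le_card_of_injOn Subtype.val (fun w hw => hmem w ?_)
        Subtype.val_injective.injOn).trans hB
      exact (SimpleGraph.ConnectedComponent.exact (Finset.mem_filter.1 hw).2).symm
  rw [Nat.card_eq_fintype_card] at hc
  simp only [Finset.card_univ, Fintype.card_coe, Finset.coe_sort_coe, hA] at hcard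
  have : (n - 2) * Fintype.card H.ConnectedComponent ≤ (n - 2) * (n - 1) :=
    Nat.mul_le_mul_left _ (by omega)
  omega
end

section
/- Let 3 ≤ n ≤ m with m < (n − 2)(n − 1). Then there exists a subset A of the vertices of the rook graph K_n □ K_m with |A| = m + 1 such that no subset of A of size n − 1 induces a connected subgraph. Consequently, the order of the scramble S*_{n,m} (whose eggs are all connected vertex subsets of size n − 1) is strictly less than (n − 1)·m. -/
/-- The scramble `S*_{n,m}` on `K_n □ K_m` whose eggs are exactly the vertex subsets of
size `n - 1` inducing connected subgraphs. -/
def SStar (n m : ℕ) : Set (Finset (Fin n × Fin m)) :=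
  {E | E.card = n - 1 ∧ ((rook n m).induce (E : Set (Fin n × Fin m))).Connected}

theorem fin_div_lt_of_lt_mul {n m : ℕ} (hm : m < (n - 2) * (n - 1)) (k : Fin (m + 1)) :
    k.val / (n - 2) < n - 1 :=
  Nat.div_lt_of_lt_mul (by omega)

/-- The `k`-th vertex, for `k ≤ m`, of a set whose components are the fibres of `k ↦ k / (n - 2)`:
vertex `0` lies in the last row above vertex `1`, and vertex `k ≥ 1` lies in column `k - 1`. -/
def blockVertex (n m : ℕ) (hn : 3 ≤ n) (hnm : n ≤ m) (hm : m < (n - 2) * (n - 1))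
    (k : Fin (m + 1)) : Fin n × Fin m :=
  if k.val = 0 then (⟨n - 1, by omega⟩, ⟨0, by omega⟩)
  else (⟨k.val / (n - 2), by
      have := fin_div_lt_of_lt_mul hm k
      omega⟩, ⟨k.val - 1, by omega⟩)

section blockVertex

variable {n m : ℕ} (hn : 3 ≤ n) (hnm : n ≤ m) (hm : m < (n - 2) * (n - 1))

theorem four_le_of_lt_mul {n m : ℕ} (hn : 3 ≤ n) (hnm : n ≤ m) (hm : m < (n - 2) * (n - 1)) :
    4 ≤ n := by
  by_contra h
  obtain rfl : n = 3 := by omega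
  omega

theorem blockVertex_injective : Function.Injective (blockVertex n m hn hnm hm) := by
  intro k l h
  have hk := fin_div_lt_of_lt_mul hm k
  have hl := fin_div_lt_of_lt_mul hm l
  ext
  unfold blockVertex at h
  split_ifs at h <;> simp only [Prod.mk.injEq, Fin.mk.injEq] at h <;> omega

theorem div_eq_of_blockVertex_adj {k l : Fin (m + 1)}
    (h : (rook n m).Adj (blockVertex n m hn hnm hm k) (blockVertex n m hn hnm hm l)) :
    k.val / (n - 2) = l.val / (n - 2) := by
  have hk := fin_div_lt_of_lt_mul hm k
  have hl := fin_div_lt_of_lt_mul hm l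
  have hn4 := four_le_of_lt_mul hn hnm hm
  have h1 : 1 / (n - 2) = 0 := Nat.div_eq_of_lt (by omega)
  rw [rook, SimpleGraph.boxProd_adj] at h
  unfold blockVertex at h
  split_ifs at h with hk0 hl0 hl0 <;>
    simp only [SimpleGraph.top_adj, ne_eq, Fin.mk.injEq] at h
  · rw [hk0, hl0]
  · have : l.val = 1 := by omega
    simp [hk0, this, h1]
  · have : k.val = 1 := by omega
    simp [hl0, this, h1]
  · rcases h with h | h
    · rw [show k.val = l.val by omega]
    · exact h.2

theorem card_filter_div_le (q L N : ℕ) (hq : 0 < q) :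
    (Finset.univ.filter fun k : Fin N => k.val / q = L).card ≤ q := by
  calc _ ≤ (Finset.Ico (L * q) (L * q + q)).card := by
        refine Finset.card_le_card_of_injOn Fin.val ?_ Fin.val_injective.injOn
        intro k hk
        have hk' : k.val / q = L := by simpa using hk
        have := (Nat.div_eq_iff hq).1 hk'
        simp only [Finset.coe_Ico, Set.mem_Ico]
        omega
    _ = q := by simp

theorem SimpleGraph.Reachable.of_adj_closed {V : Type*} {G : SimpleGraph V} {p : V → Prop}
    (hp : ∀ u v, G.Adj u v → p u → p v) {u v : V} (h : G.Reachable u v) (hu : p u) : p v := by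
  obtain ⟨w⟩ := h
  induction w with
  | nil => exact hu
  | cons hadj _ ih => exact ih (hp _ _ hadj hu)

theorem card_le_of_connected_of_subset_blockVertex {B : Finset (Fin n × Fin m)}
    (hB : B ⊆ Finset.univ.image (blockVertex n m hn hnm hm))
    (hconn : ((rook n m).induce (B : Set (Fin n × Fin m))).Connected) : B.card ≤ n - 2 := by
  obtain ⟨b⟩ := hconn.nonempty
  obtain ⟨k₀, -, hk₀⟩ := Finset.mem_image.1 (hB b.2)
  set F := Finset.univ.filter fun k : Fin (m + 1) => k.val / (n - 2) = k₀.val / (n - 2) with hF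
  have hsub : B ⊆ F.image (blockVertex n m hn hnm hm) := by
    intro c hc
    refine (hconn.preconnected b ⟨c, hc⟩).of_adj_closed
      (p := fun x => x.1 ∈ F.image (blockVertex n m hn hnm hm)) ?_ ?_
    · rintro u v huv hu
      obtain ⟨k, hk, hku⟩ := Finset.mem_image.1 hu
      obtain ⟨l, -, hlv⟩ := Finset.mem_image.1 (hB v.2)
      refine Finset.mem_image.2 ⟨l, ?_, hlv⟩
      have hadj : (rook n m).Adj u.1 v.1 := huv
      rw [← hku, ← hlv] at hadj
      have := div_eq_of_blockVertex_adj hn hnm hm hadj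
      simp only [hF, Finset.mem_filter, Finset.mem_univ, true_and] at hk ⊢
      omega
    · exact Finset.mem_image.2 ⟨k₀, by simp [hF], hk₀⟩
  calc B.card ≤ (F.image (blockVertex n m hn hnm hm)).card := Finset.card_le_card hsub
    _ ≤ F.card := Finset.card_image_le
    _ ≤ n - 2 := card_filter_div_le _ _ _ (by omega)

end blockVertex

theorem isHittingSet_compl {V : Type*} [Fintype V] [DecidableEq V] {S : Set (Finset V)}
    {A : Finset V} (h : ∀ E ∈ S, ¬ E ⊆ A) : IsHittingSet S Aᶜ := by
  intro E hE
  obtain ⟨x, hxE, hxA⟩ := Finset.not_subset.1 (h E hE)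
  exact ⟨x, by simp [hxE, hxA]⟩

theorem scrambleOrder_le_card {V : Type*} [Fintype V] [DecidableEq V] (G : SimpleGraph V)
    [DecidableRel G.Adj] {S : Set (Finset V)} {H : Finset V} (h : IsHittingSet S H) :
    scrambleOrder G S ≤ H.card :=
  (min_le_left _ _).trans (sInf_le ⟨H, h, rfl⟩)


/-- For `3 ≤ n ≤ m` with `m < (n - 2) * (n - 1)`, there is a set of `m + 1` vertices of
`K_n □ K_m` containing no connected subset of size `n - 1`; consequently the order of the
scramble `S*_{n,m}` is strictly less than `(n - 1) * m`. -/
theorem sstar_order_small (n m : ℕ) (hn : 3 ≤ n) (hnm : n ≤ m)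
    (hm : m < (n - 2) * (n - 1)) :
    (∃ A : Finset (Fin n × Fin m), A.card = m + 1 ∧
      ∀ B ⊆ A, B.card = n - 1 →
        ¬ ((rook n m).induce (B : Set (Fin n × Fin m))).Connected) ∧
    scrambleOrder (rook n m) (SStar n m) < (((n - 1) * m : ℕ) : ℕ∞) := by
  have hA : ∃ A : Finset (Fin n × Fin m), A.card = m + 1 ∧
      ∀ B ⊆ A, B.card = n - 1 →
        ¬ ((rook n m).induce (B : Set (Fin n × Fin m))).Connected := by
    refine ⟨Finset.univ.image (blockVertex n m hn hnm hm), ?_, ?_⟩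
    · rw [Finset.card_image_of_injective _ (blockVertex_injective hn hnm hm)]
      simp
    · intro B hB hcard hconn
      have := card_le_of_connected_of_subset_blockVertex hn hnm hm hB hconn
      omega
  refine ⟨hA, ?_⟩
  obtain ⟨A, hcard, hB⟩ := hA
  have hhit : IsHittingSet (SStar n m) Aᶜ :=
    isHittingSet_compl fun E hE hEA => hB E hEA hE.1 hE.2
  refine (scrambleOrder_le_card (rook n m) hhit).trans_lt (Nat.cast_lt.2 ?_)
  have hle := A.card_le_univ
  rw [Finset.card_compl]
  simp only [Fintype.card_prod, Fintype.card_fin] at hle ⊢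
  rw [Nat.sub_mul, one_mul, hcard]
  have : m + 1 ≤ n * m := hcard ▸ hle
  omega
end
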